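/- arXiv:1305.6844 — 3 statements merged into one kernel-verified Lean document; each statement's English description precedes it below -/
import Mathlib

section
/- A Boolean C-algebra B is u-compact if and only if for every k ∈ ℕ there exists no E_k-system over B. -/
/-- Terms of the language of Boolean algebras extended by constants `cᵢ, i ∈ I`,
in the variables `x₁, …, xₙ`. -/
inductive BTerm (I : Type) (n : ℕ) : Type where
  | var : Fin n → BTerm I n
  | const : I → BTerm I n
  | bot : BTerm I n
  | top : BTerm I n
  | sup : BTerm I n → BTerm I n → BTerm I n
  | inf : BTerm I n → BTerm I n → BTerm I n
  | compl : BTerm I n → BTerm I n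

/-- Evaluation of a term in a Boolean algebra `B`, where the constant symbols are
interpreted via `c : I → B` and the variables via `b : Fin n → B`. -/
def BTerm.eval {I B : Type} [BooleanAlgebra B] (c : I → B) {n : ℕ} :
    BTerm I n → (Fin n → B) → B
  | .var i, b => b i
  | .const j, _ => c j
  | .bot, _ => ⊥
  | .top, _ => ⊤
  | .sup t s, b => t.eval c b ⊔ s.eval c b
  | .inf t s, b => t.eval c b ⊓ s.eval c b
  | .compl t, b => (t.eval c b)ᶜ

/-- An equation `t(X) = s(X)` is a pair of terms. -/
abbrev BEqn (I : Type) (n : ℕ) := BTerm I n × BTerm I n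

/-- The solution set `V_B(S)` of a system of equations `S`. -/
def solSet {I B : Type} [BooleanAlgebra B] (c : I → B) {n : ℕ}
    (S : Set (BEqn I n)) : Set (Fin n → B) :=
  {b | ∀ e ∈ S, e.1.eval c b = e.2.eval c b}

/-- The subalgebra `C ⊆ B` generated by the interpretations of the constants:
the set of values of all closed terms. -/
def constSubalg {I B : Type} [BooleanAlgebra B] (c : I → B) : Set B :=
  Set.range fun t : BTerm I 0 => t.eval c (fun i => i.elim0)

/-- A system `S` over `B` is an `E_k`-system if `|V_B(S)| = k` while every finite
subsystem of `S` has an infinite solution set. -/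
def IsEkSystem {I B : Type} [BooleanAlgebra B] (c : I → B) {n : ℕ}
    (S : Set (BEqn I n)) (k : ℕ) : Prop :=
  (solSet c S).Finite ∧ (solSet c S).ncard = k ∧
    ∀ Sp ⊆ S, Sp.Finite → (solSet c Sp).Infinite

/-- `B` is u-compact: whenever `V_B(S) ⊆ ⋃ᵢ V_B(tᵢ = sᵢ)` for a finite family of
equations, some finite subsystem `S' ⊆ S` already satisfies
`V_B(S') ⊆ ⋃ᵢ V_B(tᵢ = sᵢ)`. -/
def UCompact {I B : Type} [BooleanAlgebra B] (c : I → B) : Prop :=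
  ∀ (n m : ℕ) (S : Set (BEqn I n)) (es : Fin m → BEqn I n),
    solSet c S ⊆ ⋃ i, solSet c {es i} →
    ∃ Sp ⊆ S, Sp.Finite ∧ solSet c Sp ⊆ ⋃ i, solSet c {es i}

namespace BTerm

/-- Renaming of variables. -/
def rename {I : Type} {n m : ℕ} (f : Fin n → Fin m) : BTerm I n → BTerm I m
  | .var i => .var (f i)
  | .const j => .const j
  | .bot => .bot
  | .top => .top
  | .sup t s => .sup (t.rename f) (s.rename f)
  | .inf t s => .inf (t.rename f) (s.rename f)
  | .compl t => .compl (t.rename f)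

theorem eval_rename {I B : Type} [BooleanAlgebra B] (c : I → B) {n m : ℕ} (f : Fin n → Fin m)
    (t : BTerm I n) (b : Fin m → B) : (t.rename f).eval c b = t.eval c (fun i => b (f i)) := by
  induction t <;> simp_all [rename, eval]

/-- Locality of evaluation. -/
theorem eval_local {I B : Type} [BooleanAlgebra B] (c : I → B) {n : ℕ} (t : BTerm I n)
    (a b : Fin n → B) (d : B) (h : ∀ j, a j ⊓ d = b j ⊓ d) :
    t.eval c a ⊓ d = t.eval c b ⊓ d := by
  induction t with
  | var i => exact h i
  | const j => rfl
  | bot => rfl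
  | top => rfl
  | sup t s iht ihs => simp only [eval, inf_sup_right, iht, ihs]
  | inf t s iht ihs =>
    simp only [eval]
    rw [inf_inf_distrib_right, iht, ihs, ← inf_inf_distrib_right]
  | compl t ih =>
    simp only [eval]
    have key : ∀ x : B, xᶜ ⊓ d = (x ⊓ d)ᶜ ⊓ d := by
      intro x
      simp [compl_inf, inf_sup_right]
    rw [key, ih, ← key]

/-- Finite join. -/
def bsup {I : Type} {n : ℕ} : List (BTerm I n) → BTerm I n
  | [] => .bot
  | t :: l => .sup t (bsup l)

theorem eval_bsup {I B : Type} [BooleanAlgebra B] (c : I → B) {n : ℕ} (l : List (BTerm I n))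
    (b : Fin n → B) : (bsup l).eval c b = ⊥ ↔ ∀ t ∈ l, t.eval c b = ⊥ := by
  induction l with
  | nil => simp [bsup, eval]
  | cons t l ih => simp [bsup, eval, ih]

/-- Difference term. -/
def sd {I : Type} {n : ℕ} (t s : BTerm I n) : BTerm I n := .inf t (.compl s)

theorem eval_sd {I B : Type} [BooleanAlgebra B] (c : I → B) {n : ℕ} (t s : BTerm I n)
    (b : Fin n → B) : (sd t s).eval c b = ⊥ ↔ t.eval c b ≤ s.eval c b := by
  simp only [sd, eval]
  rw [← sdiff_eq, sdiff_eq_bot_iff]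

/-- Symmetric difference of the sides of an equation. -/
def sym {I : Type} {n : ℕ} (e : BEqn I n) : BTerm I n := .sup (sd e.1 e.2) (sd e.2 e.1)

theorem eval_sym {I B : Type} [BooleanAlgebra B] (c : I → B) {n : ℕ} (e : BEqn I n)
    (b : Fin n → B) : (sym e).eval c b = ⊥ ↔ e.1.eval c b = e.2.eval c b := by
  have : (sym e).eval c b = (sd e.1 e.2).eval c b ⊔ (sd e.2 e.1).eval c b := rfl
  rw [this, sup_eq_bot_iff, eval_sd, eval_sd, le_antisymm_iff]

/-- The combined equation in variables `y = x_0`, `X = x_1..x_n`: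
`e` holds on `y`, `y ≤ t(X)`, `X ≤ y`. -/
def phi {I : Type} {n : ℕ} (t : BTerm I n) (e : BEqn I n) : BEqn I (n + 1) :=
  (bsup (.inf ((sym e).rename Fin.succ) (.var 0) :: sd (.var 0) (t.rename Fin.succ) ::
    List.ofFn (fun j : Fin n => sd (.var j.succ) (.var 0))), .bot)

theorem phi_iff {I B : Type} [BooleanAlgebra B] (c : I → B) {n : ℕ} (t : BTerm I n)
    (e : BEqn I n) (b : Fin (n + 1) → B) :
    (phi t e).1.eval c b = (phi t e).2.eval c b ↔
      (sym e).eval c (fun j => b j.succ) ⊓ b 0 = ⊥ ∧ b 0 ≤ t.eval c (fun j => b j.succ) ∧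
        ∀ j : Fin n, b j.succ ≤ b 0 := by
  have h2 : (phi t e).2.eval c b = ⊥ := rfl
  rw [h2]
  unfold phi
  simp only [eval_bsup, List.mem_cons, List.mem_ofFn, forall_eq_or_imp, eval_sd,
    forall_exists_index, forall_apply_eq_imp_iff, eval_rename]
  simp only [eval, eval_rename]

end BTerm

open BTerm

theorem solSet_anti {I B : Type} [BooleanAlgebra B] (c : I → B) {n : ℕ}
    {S T : Set (BEqn I n)} (h : S ⊆ T) : solSet c T ⊆ solSet c S :=
  fun _ hb e he => hb e (h he)

theorem finite_sub_of_noEk {I B : Type} [BooleanAlgebra B] (c : I → B)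
    (H : ∀ (k n : ℕ) (S : Set (BEqn I n)), ¬ IsEkSystem c S k) {n : ℕ} (S : Set (BEqn I n))
    (hS : (solSet c S).Finite) : ∃ Sp ⊆ S, Sp.Finite ∧ solSet c Sp ⊆ solSet c S := by
  have h1 : ∃ Sp ⊆ S, Sp.Finite ∧ (solSet c Sp).Finite := by
    by_contra hcon
    push Not at hcon
    exact H _ n S ⟨hS, rfl, fun Sp h1 h2 => hcon Sp h1 h2⟩
  obtain ⟨S0, h0, hf0, hV0⟩ := h1
  have h2 : ∀ b : Fin n → B, ∃ e : Set (BEqn I n), e ⊆ S ∧ e.Finite ∧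
      (b ∉ solSet c S → b ∉ solSet c e) := by
    intro b
    by_cases hb : b ∈ solSet c S
    · exact ⟨∅, by simp, by simp, fun h => absurd hb h⟩
    · have hb' := hb
      simp only [solSet, Set.mem_ofPred_eq] at hb'
      push Not at hb'
      obtain ⟨e, he, hne⟩ := hb'
      exact ⟨{e}, by simpa using he, by simp, fun _ h => hne (h e rfl)⟩
  choose g hg1 hg2 hg3 using h2
  refine ⟨S0 ∪ ⋃ b ∈ solSet c S0, g b, ?_, ?_, ?_⟩
  · exact Set.union_subset h0 (Set.iUnion₂_subset fun b _ => hg1 b)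
  · exact hf0.union (hV0.biUnion fun b _ => hg2 b)
  · intro b hb
    by_contra hcon
    have hb0 : b ∈ solSet c S0 := solSet_anti c Set.subset_union_left hb
    exact hg3 b hcon (solSet_anti c ((Set.subset_biUnion_of_mem hb0).trans
      Set.subset_union_right) hb)

/-- A lower set all of whose nonzero elements are above an element of a finite family of
nonzero elements is finite. -/
theorem finite_lower {B ι : Type} [BooleanAlgebra B] (D : Set B)
    (hD : ∀ d ∈ D, ∀ e ≤ d, e ∈ D) (A : Finset ι) (y : ι → B) (hy : ∀ i ∈ A, y i ≠ ⊥)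
    (h : ∀ d ∈ D, d ≠ ⊥ → ∃ i ∈ A, y i ≤ d) : D.Finite := by
  classical
  have key : ∀ d ∈ D, ∀ e ∈ D, A.filter (fun i => y i ≤ d) = A.filter (fun i => y i ≤ e) →
      d ≤ e := by
    intro d hd e _ hde
    by_contra hcon
    have hne : d \ e ≠ ⊥ := fun h => hcon (sdiff_eq_bot_iff.mp h)
    obtain ⟨i, hi, hle⟩ := h (d \ e) (hD d hd _ sdiff_le) hne
    have h1 : i ∈ A.filter (fun i => y i ≤ d) := by simp [hi, hle.trans sdiff_le]
    rw [hde, Finset.mem_filter] at h1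
    exact hy i hi (le_bot_iff.mp (by
      calc y i ≤ (d \ e) ⊓ e := le_inf hle h1.2
        _ = ⊥ := by simp))
  refine Set.Finite.of_finite_image (f := fun d => A.filter (fun i => y i ≤ d)) ?_ ?_
  · exact (A.powerset.finite_toSet).subset (by
      rintro _ ⟨d, _, rfl⟩
      exact Finset.mem_coe.2 (Finset.mem_powerset.2 (Finset.filter_subset _ _)))
  · intro d hd e he hde
    exact le_antisymm (key d hd e he hde) (key e he d hd hde.symm)

/-- Glueing of two tuples. -/
def glue {B : Type} [BooleanAlgebra B] {n : ℕ} (d : B) (X q : Fin n → B) : Fin n → B :=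
  fun j => (X j ⊓ d) ⊔ (q j ⊓ dᶜ)

theorem glue_eval {I B : Type} [BooleanAlgebra B] (c : I → B) {n : ℕ} (t : BTerm I n) (d : B)
    (X q : Fin n → B) : t.eval c (glue d X q) ⊓ d = t.eval c X ⊓ d ∧
      t.eval c (glue d X q) ⊓ dᶜ = t.eval c q ⊓ dᶜ := by
  constructor
  · apply eval_local
    intro j
    simp [glue, inf_sup_right, inf_assoc]
  · apply eval_local
    intro j
    simp [glue, inf_sup_right, inf_assoc]

theorem glue_sol {I B : Type} [BooleanAlgebra B] (c : I → B) {n : ℕ} (S : Set (BEqn I n)) (d : B)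
    (X q : Fin n → B) (hq : q ∈ solSet c S) (hX : ∀ e ∈ S, (sym e).eval c X ⊓ d = ⊥) :
    glue d X q ∈ solSet c S := by
  intro e he
  rw [← eval_sym]
  obtain ⟨h1, h2⟩ := glue_eval c (sym e) d X q
  rw [hX e he] at h1
  rw [(eval_sym c e q).2 (hq e he), bot_inf_eq] at h2
  rw [← inf_top_eq ((sym e).eval c (glue d X q)), ← sup_compl_eq_top (x := d), inf_sup_left,
    h1, h2, sup_bot_eq]

theorem backward {I B : Type} [BooleanAlgebra B] (c : I → B)
    (H : ∀ (k n : ℕ) (S : Set (BEqn I n)), ¬ IsEkSystem c S k) : UCompact c := by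
  classical
  intro n m S es hS
  rcases S.eq_empty_or_nonempty with rfl | ⟨e0, he0⟩
  · exact ⟨∅, le_rfl, Set.finite_empty, hS⟩
  by_contra hcon
  push Not at hcon
  have hp : (solSet c S).Nonempty := by
    by_contra hemp
    rw [Set.not_nonempty_iff_eq_empty] at hemp
    obtain ⟨Sp, h1, h2, h3⟩ := finite_sub_of_noEk c H S (by simp [hemp])
    exact hcon Sp h1 h2 (h3.trans hS)
  obtain ⟨p, hp⟩ := hp
  let t : Fin m → BTerm I n := fun i => sym (es i)
  let W : Fin m → Set (Fin (n + 1) → B) := fun i => solSet c (phi (t i) '' S)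
  have memW : ∀ i b, b ∈ W i ↔ ∀ e ∈ S, (sym e).eval c (fun j => b j.succ) ⊓ b 0 = ⊥ ∧
      b 0 ≤ (t i).eval c (fun j => b j.succ) ∧ ∀ j : Fin n, b j.succ ≤ b 0 := by
    intro i b
    simp only [W, solSet, Set.mem_ofPred_eq, Set.forall_mem_image, phi_iff]
  let D : Fin m → Set B := fun i => (fun b => b 0) '' W i
  have restr : ∀ (T : Set (BEqn I n)) i (q : Fin n → B) (d : B),
      (∀ e ∈ T, (sym e).eval c q ⊓ d = ⊥) → d ≤ (t i).eval c q →
      (Fin.cons d (fun j => q j ⊓ d) : Fin (n + 1) → B) ∈ solSet c (phi (t i) '' T) := by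
    intro T i q d h1 h2
    simp only [solSet, Set.mem_ofPred_eq, Set.forall_mem_image, phi_iff, Fin.cons_zero,
      Fin.cons_succ]
    have hl : ∀ s : BTerm I n, s.eval c (fun j => q j ⊓ d) ⊓ d = s.eval c q ⊓ d := fun s =>
      eval_local c s _ _ d (fun j => by simp)
    intro e he
    refine ⟨by rw [hl, h1 e he], ?_, fun j => inf_le_right⟩
    have := hl (t i)
    rw [inf_eq_right.2 h2] at this
    exact inf_eq_right.1 this
  have Dlow : ∀ i, ∀ d ∈ D i, ∀ e ≤ d, e ∈ D i := by
    rintro i _ ⟨b, hb, rfl⟩ d hd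
    rw [memW] at hb
    refine ⟨_, restr S i (fun j => b j.succ) d ?_ (hd.trans (hb e0 he0).2.1), rfl⟩
    intro e he
    exact le_bot_iff.1 ((inf_le_inf_left _ hd).trans (hb e he).1.le)
  have Wfin : ∀ i, (D i).Finite → (W i).Finite := by
    intro i hi
    refine (Set.Finite.pi' (fun _ : Fin (n + 1) => hi)).subset ?_
    intro b hb j
    have h0 : b 0 ∈ D i := ⟨b, hb, rfl⟩
    refine Fin.cases h0 (fun j => ?_) j
    exact Dlow i _ h0 _ (((memW i b).1 hb e0 he0).2.2 j)
  have hfin : ∀ i, ∃ Sp ⊆ S, Sp.Finite ∧ ((D i).Finite → solSet c (phi (t i) '' Sp) ⊆ W i) := by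
    intro i
    by_cases hi : (D i).Finite
    · obtain ⟨Q, h1, h2, h3⟩ := finite_sub_of_noEk c H (phi (t i) '' S) (Wfin i hi)
      obtain ⟨Sp, h4, h5, h6⟩ := (Set.exists_subset_image_finite_and
        (p := fun Q => solSet c Q ⊆ W i)).1 ⟨Q, h1, h2, h3⟩
      exact ⟨Sp, h4, h5, fun _ => h6⟩
    · exact ⟨∅, by simp, by simp, fun h => absurd h hi⟩
  choose F hF1 hF2 hF3 using hfin
  have start : ∃ q ∈ solSet c S, ∀ i, (D i).Finite → (t i).eval c q ≠ ⊥ := by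
    have hq := hcon (⋃ i, F i) (Set.iUnion_subset hF1) (Set.finite_iUnion hF2)
    obtain ⟨q, hq, hqn⟩ := Set.not_subset.1 hq
    have hqn' : ∀ i, (t i).eval c q ≠ ⊥ := by
      intro i hi
      refine hqn (Set.mem_iUnion.2 ⟨i, ?_⟩)
      rintro e rfl
      exact (eval_sym c _ q).1 hi
    let y : B := (Finset.univ.filter (fun i => (D i).Finite)).sup (fun i => (t i).eval c q)
    refine ⟨glue y q p, glue_sol c S y q p hp ?_, ?_⟩
    · intro e he
      simp only [y]
      rw [Finset.sup_inf_distrib_left]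
      rw [Finset.sup_eq_bot_iff]
      intro i hi
      have hi' : (D i).Finite := by simpa using hi
      have hmem := hF3 i hi' (restr (F i) i q ((t i).eval c q) (by
        intro e' he'
        rw [(eval_sym c e' q).2 (hq e' (Set.mem_iUnion.2 ⟨i, he'⟩)), bot_inf_eq]) le_rfl)
      have h1 := ((memW i _).1 hmem e he).1
      simp only [Fin.cons_zero, Fin.cons_succ] at h1
      rw [← h1]
      exact eval_local c _ _ _ _ (fun j => by simp)
    · intro i hi h0
      have h1 := (glue_eval c (t i) y q p).1
      have hle : (t i).eval c q ≤ y :=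
        Finset.le_sup (f := fun i => (t i).eval c q) (by simpa using hi)
      rw [h0, bot_inf_eq, inf_eq_left.2 hle] at h1
      exact hqn' i h1.symm
  have main : ∀ A : Finset (Fin m), ∃ q ∈ solSet c S,
      ∀ i, ((D i).Finite ∨ i ∈ A) → (t i).eval c q ≠ ⊥ := by
    intro A
    induction A using Finset.induction_on with
    | empty => simpa using start
    | insert a A ha ih =>
      by_cases hfa : (D a).Finite
      · obtain ⟨q, hq, h⟩ := ih
        refine ⟨q, hq, fun i hi => h i ?_⟩
        rcases hi with hi | hi
        · exact Or.inl hi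
        · rcases Finset.mem_insert.1 hi with rfl | hi
          · exact Or.inl hfa
          · exact Or.inr hi
      · obtain ⟨q, hq, h⟩ := ih
        have hd : ∃ d ∈ D a, d ≠ ⊥ ∧ ∀ i, ((D i).Finite ∨ i ∈ A) → ¬ (t i).eval c q ≤ d := by
          by_contra hno
          push Not at hno
          refine hfa (finite_lower (D a) (Dlow a)
            (Finset.univ.filter (fun i => (D i).Finite ∨ i ∈ A))
            (fun i => (t i).eval c q) (fun i hi => h i (by simpa using hi)) ?_)
          intro d hd hne
          obtain ⟨i, hi, hle⟩ := hno d hd hne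
          exact ⟨i, by simpa using hi, hle⟩
        obtain ⟨_, ⟨b, hb, rfl⟩, hne, hnle⟩ := hd
        rw [memW] at hb
        dsimp only at hne hnle
        refine ⟨glue (b 0) (fun j => b j.succ) q,
          glue_sol c S _ _ q hq (fun e he => (hb e he).1), ?_⟩
        intro i hi h0
        obtain ⟨g1, g2⟩ := glue_eval c (t i) (b 0) (fun j => b j.succ) q
        rw [h0, bot_inf_eq] at g1 g2
        by_cases hia : i = a
        · subst hia
          rw [inf_eq_right.2 (hb e0 he0).2.1] at g1
          exact hne g1.symm
        · refine hnle i (hi.imp_right fun h => (Finset.mem_insert.1 h).resolve_left hia) ?_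
          rw [← sdiff_eq_bot_iff, sdiff_eq]
          exact g2.symm
  obtain ⟨q, hq, hqn⟩ := main Finset.univ
  obtain ⟨i, hi⟩ := Set.mem_iUnion.1 (hS hq)
  exact hqn i (Or.inr (Finset.mem_univ i)) ((eval_sym c _ q).2 (hi _ rfl))

theorem forward {I B : Type} [BooleanAlgebra B] (c : I → B) (hU : UCompact c)
    (k n : ℕ) (S : Set (BEqn I n)) : ¬ IsEkSystem c S k := by
  classical
  rintro ⟨hfin, hk, hinf⟩
  let v : Fin (k + 1) → Fin n → Fin ((k + 1) * n) := fun i j => finProdFinEquiv (i, j)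
  let g : Fin (k + 1) × BEqn I n → BEqn I ((k + 1) * n) := fun x =>
    (x.2.1.rename (v x.1), x.2.2.rename (v x.1))
  let P := {x : Fin (k + 1) × Fin (k + 1) // x.1 ≠ x.2}
  let eqv : P ≃ Fin (Fintype.card P) := Fintype.equivFin P
  let E : P → BEqn I ((k + 1) * n) := fun x =>
    (bsup (List.ofFn fun j : Fin n => sym (.var (v x.1.1 j), .var (v x.1.2 j))), .bot)
  have hE : ∀ (x : P) b, b ∈ solSet c {E x} ↔ ∀ j, b (v x.1.1 j) = b (v x.1.2 j) := by
    intro x b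
    have : b ∈ solSet c {E x} ↔ (E x).1.eval c b = ⊥ := by
      simp only [solSet, Set.mem_ofPred_eq, Set.mem_singleton_iff, forall_eq]
      exact Iff.rfl
    rw [this]
    simp only [E, eval_bsup, List.mem_ofFn, forall_exists_index, forall_apply_eq_imp_iff,
      eval_sym]
    simp only [eval]
  have hg : ∀ x b, (g x).1.eval c b = (g x).2.eval c b ↔
      x.2.1.eval c (fun j => b (v x.1 j)) = x.2.2.eval c (fun j => b (v x.1 j)) := by
    intro x b
    simp only [g, eval_rename]
  obtain ⟨Sp, h1, h2, h3⟩ := hU _ _ (g '' (Set.univ ×ˢ S)) (fun i => E (eqv.symm i)) (by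
    intro b hb
    have hsol : ∀ i, (fun j => b (v i j)) ∈ solSet c S := fun i e he =>
      (hg (i, e) b).1 (hb _ ⟨(i, e), ⟨trivial, he⟩, rfl⟩)
    have hni : ¬ Function.Injective (fun (i : Fin (k + 1)) (j : Fin n) => b (v i j)) := by
      intro hinj
      have := Set.ncard_le_ncard (Set.range_subset_iff.2 hsol) hfin
      rw [hk, Set.ncard_range_of_injective hinj] at this
      simp at this
    simp only [Function.Injective] at hni
    push Not at hni
    obtain ⟨i, i', heq, hne⟩ := hni
    refine Set.mem_iUnion.2 ⟨eqv ⟨(i, i'), hne⟩, ?_⟩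
    simp only [Equiv.symm_apply_apply]
    rw [hE]
    exact fun j => congrFun heq j)
  obtain ⟨T, hT, hTf, hT3⟩ := (Set.exists_subset_image_finite_and
    (p := fun Q => solSet c Q ⊆ ⋃ i, solSet c {E (eqv.symm i)})).1 ⟨Sp, h1, h2, h3⟩
  have hI := hinf (Prod.snd '' T) (by
    rintro _ ⟨x, hx, rfl⟩
    exact (hT hx).2) (hTf.image _)
  let f := hI.natEmbedding
  let b : Fin ((k + 1) * n) → B := fun l =>
    (f (finProdFinEquiv.symm l).1 : Fin n → B) (finProdFinEquiv.symm l).2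
  have hb : ∀ i j, b (v i j) = (f (i : ℕ) : Fin n → B) j := by
    intro i j
    simp only [b, v, Equiv.symm_apply_apply]
  have hbs : b ∈ solSet c (g '' T) := by
    rintro _ ⟨x, hx, rfl⟩
    rw [hg]
    simp only [hb]
    exact (f x.1).2 x.2 ⟨x, hx, rfl⟩
  obtain ⟨i, hi⟩ := Set.mem_iUnion.1 (hT3 hbs)
  rw [hE] at hi
  simp only [hb] at hi
  exact (eqv.symm i).2 (Fin.ext (f.injective (Subtype.ext (funext hi))))

/-- Theorem 7: a Boolean C-algebra `B` is u-compact iff for every `k ∈ ℕ` there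
is no `E_k`-system over `B`. -/
theorem uCompact_iff_no_Ek {I B : Type} [BooleanAlgebra B] (c : I → B) :
    UCompact c ↔
      ∀ (k n : ℕ) (S : Set (BEqn I n)), ¬ IsEkSystem c S k := by
  exact ⟨fun h k n S => forward c h k n S, backward c⟩
end

section
/- Two Boolean C-algebras B₁, B₂ (whose constant symbols generate the same subalgebra C) are geometrically equivalent if and only if the following two conditions hold: (1) every system of equations that is inconsistent over B₁ is inconsistent over B₂ and vice versa; and (2) for every set of constants {c_j | j ∈ J} ⊆ C, the infimum of this set exists in B₁ and equals 0 if and only if the infimum of the same set exists in B₂ and equals 0. -/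
/-- The radical `Rad_B(S)`: the set of all equations that hold on `V_B(S)`. -/
def radical {I B : Type} [BooleanAlgebra B] (c : I → B) {n : ℕ}
    (S : Set (BEqn I n)) : Set (BEqn I n) :=
  {e | solSet c S ⊆ solSet c {e}}

/-- Two Boolean C-algebras are geometrically equivalent if every system of
equations has the same radical over both of them. -/
def GeomEquiv {I B₁ B₂ : Type} [BooleanAlgebra B₁] [BooleanAlgebra B₂]
    (c₁ : I → B₁) (c₂ : I → B₂) : Prop :=
  ∀ (n : ℕ) (S : Set (BEqn I n)), radical c₁ S = radical c₂ S

/-- The constant symbols generate the same subalgebra `C` in both algebras: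
two closed terms have equal values in `B₁` iff they have equal values in `B₂`
(so the subalgebras generated by the constants are canonically isomorphic). -/
def SameConstAlg {I B₁ B₂ : Type} [BooleanAlgebra B₁] [BooleanAlgebra B₂]
    (c₁ : I → B₁) (c₂ : I → B₂) : Prop :=
  ∀ t s : BTerm I 0,
    t.eval c₁ (fun i => i.elim0) = s.eval c₁ (fun i => i.elim0) ↔
    t.eval c₂ (fun i => i.elim0) = s.eval c₂ (fun i => i.elim0)

theorem BTerm.eval_local_s9 {I B : Type} [BooleanAlgebra B] (c : I → B) {n : ℕ} (u : B)
    (a b : Fin n → B) (h : ∀ i, a i ⊓ u = b i ⊓ u) (r : BTerm I n) :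
    r.eval c a ⊓ u = r.eval c b ⊓ u := by
  induction r with
  | var i => exact h i
  | const j => rfl
  | bot => rfl
  | top => rfl
  | sup t s iht ihs => simp only [BTerm.eval, inf_sup_right, iht, ihs]
  | inf t s iht ihs =>
    simp only [BTerm.eval]
    rw [inf_inf_distrib_right, iht, ihs, ← inf_inf_distrib_right]
  | compl t iht =>
    simp only [BTerm.eval]
    have key : ∀ x : B, xᶜ ⊓ u = u ⊓ (x ⊓ u)ᶜ := by
      intro x
      rw [compl_inf, inf_sup_left, inf_compl_self, sup_bot_eq, inf_comm]
    rw [key, iht, ← key]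

/-- Substitute truth values for the variables. -/
def BTerm.inst {I : Type} {n : ℕ} (α : Fin n → Bool) : BTerm I n → BTerm I 0
  | .var i => if α i then .top else .bot
  | .const j => .const j
  | .bot => .bot
  | .top => .top
  | .sup t s => .sup (t.inst α) (s.inst α)
  | .inf t s => .inf (t.inst α) (s.inst α)
  | .compl t => .compl (t.inst α)

theorem BTerm.eval_inst {I B : Type} [BooleanAlgebra B] (c : I → B) {n : ℕ}
    (α : Fin n → Bool) (z : Fin 0 → B) (r : BTerm I n) :
    (r.inst α).eval c z = r.eval c (fun i => if α i then ⊤ else ⊥) := by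
  induction r with
  | var i => by_cases h : α i <;> simp [BTerm.inst, BTerm.eval, h]
  | const j => rfl
  | bot => rfl
  | top => rfl
  | sup t s iht ihs => simp only [BTerm.inst, BTerm.eval, iht, ihs]
  | inf t s iht ihs => simp only [BTerm.inst, BTerm.eval, iht, ihs]
  | compl t iht => simp only [BTerm.inst, BTerm.eval, iht]

/-- The term expressing the symmetric difference of both sides of an equation. -/
def eqnDiff {I : Type} {n : ℕ} (e : BEqn I n) : BTerm I n :=
  .sup (.inf e.1 (.compl e.2)) (.inf e.2 (.compl e.1))

theorem eqnDiff_eval {I B : Type} [BooleanAlgebra B] (c : I → B) {n : ℕ}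
    (e : BEqn I n) (b : Fin n → B) :
    (eqnDiff e).eval c b = ⊥ ↔ e.1.eval c b = e.2.eval c b := by
  rw [← symmDiff_eq_bot (a := e.1.eval c b), symmDiff_eq]
  rfl

theorem exists_point {B : Type} [BooleanAlgebra B] (n : ℕ) :
    ∀ (b : Fin n → B) (u : B), u ≠ ⊥ → ∃ v, v ≠ ⊥ ∧ v ≤ u ∧ ∃ α : Fin n → Bool,
      ∀ i, b i ⊓ v = (if α i then ⊤ else ⊥) ⊓ v := by
  induction n with
  | zero => exact fun b u hu => ⟨u, hu, le_rfl, fun i => i.elim0, fun i => i.elim0⟩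
  | succ n ih =>
    intro b u hu
    obtain ⟨v, hv, hvu, α, hα⟩ := ih (fun i => b i.succ) u hu
    have mono : ∀ w ≤ v, ∀ i : Fin n, b i.succ ⊓ w = (if α i then ⊤ else ⊥) ⊓ w := by
      intro w hw i
      have := congrArg (· ⊓ w) (hα i)
      simpa only [inf_assoc, inf_eq_right.2 hw] using this
    by_cases h : v ⊓ b 0 = ⊥
    · refine ⟨v, hv, hvu, Fin.cons false α, fun i => ?_⟩
      refine Fin.cases ?_ (fun i => ?_) i
      · simp [inf_comm, h]
      · simpa using hα i
    · refine ⟨v ⊓ b 0, h, inf_le_left.trans hvu, Fin.cons true α, fun i => ?_⟩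
      refine Fin.cases ?_ (fun i => ?_) i
      · simp
      · simpa using mono (v ⊓ b 0) inf_le_left i

theorem isGLB_bot_iff' {B : Type} [BooleanAlgebra B] (T : Set B) :
    IsGLB T ⊥ ↔ ∀ d, (∀ t ∈ T, d ≤ t) → d = ⊥ := by
  constructor
  · intro h d hd
    exact le_bot_iff.1 (h.2 hd)
  · intro h
    exact ⟨fun _ _ => bot_le, fun d hd => (h d hd).le⟩

theorem radical_sub {I B₁ B₂ : Type} [BooleanAlgebra B₁] [BooleanAlgebra B₂]
    (c₁ : I → B₁) (c₂ : I → B₂) {n : ℕ} (S : Set (BEqn I n))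
    (h1 : solSet c₁ S = ∅ → solSet c₂ S = ∅)
    (h2 : ∀ T : Set (BTerm I 0),
          IsGLB ((fun t : BTerm I 0 => t.eval c₁ (fun i => i.elim0)) '' T)
            (⊥ : B₁) →
          IsGLB ((fun t : BTerm I 0 => t.eval c₂ (fun i => i.elim0)) '' T)
            (⊥ : B₂)) : radical c₁ S ⊆ radical c₂ S := by
  intro e he b hb
  have hne : (solSet c₁ S).Nonempty := by
    by_contra h
    have := h1 (Set.not_nonempty_iff_eq_empty.1 h)
    rw [this] at hb
    exact hb
  obtain ⟨a, ha⟩ := hne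
  intro e' he'
  obtain rfl : e' = e := he'
  by_contra hcon
  rw [← eqnDiff_eval] at hcon
  obtain ⟨v, hv, hvu, α, hα⟩ := exists_point n b _ hcon
  have hloc := BTerm.eval_local_s9 c₂ v b _ hα
  let T : Set (BTerm I 0) :=
    insert ((eqnDiff e').inst α) ((fun f => ((eqnDiff f).inst α).compl) '' S)
  have hT2 : ¬ IsGLB ((fun t : BTerm I 0 => t.eval c₂ (fun i => i.elim0)) '' T) (⊥ : B₂) := by
    rw [isGLB_bot_iff']
    intro h
    refine hv (h v ?_)
    rintro _ ⟨t, ht, rfl⟩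
    rcases ht with rfl | ⟨f, hf, rfl⟩
    · simp only [BTerm.eval_inst]
      rw [← inf_eq_right, ← hloc, inf_eq_right]
      exact hvu
    · simp only [BTerm.eval, BTerm.eval_inst]
      rw [le_compl_iff_disjoint_left, disjoint_iff, ← hloc, (eqnDiff_eval c₂ f b).2 (hb f hf),
        bot_inf_eq]
  have hT1 := mt (h2 T) hT2
  rw [isGLB_bot_iff'] at hT1
  push Not at hT1
  obtain ⟨d, hd, hd0⟩ := hT1
  have hdt := hd _ ⟨_, Set.mem_insert _ _, rfl⟩
  have hdS := fun f (hf : f ∈ S) => hd _ ⟨_, Set.mem_insert_of_mem _ ⟨f, hf, rfl⟩, rfl⟩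
  simp only [BTerm.eval, BTerm.eval_inst] at hdt hdS
  let p : Fin n → B₁ := fun i => if α i then ⊤ else ⊥
  let q : Fin n → B₁ := fun i => (a i ⊓ dᶜ) ⊔ (p i ⊓ d)
  have q1 := BTerm.eval_local_s9 c₁ d q p (fun i => by
    simp only [q]
    rw [inf_sup_right, inf_assoc, compl_inf_self, inf_bot_eq, bot_sup_eq, inf_assoc, inf_idem])
  have q2 := BTerm.eval_local_s9 c₁ dᶜ q a (fun i => by
    simp only [q]
    rw [inf_sup_right, inf_assoc, inf_idem, inf_assoc, inf_compl_self, inf_bot_eq, sup_bot_eq])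
  have hq : q ∈ solSet c₁ S := by
    intro f hf
    rw [← eqnDiff_eval]
    have e1 : (eqnDiff f).eval c₁ q ⊓ d = ⊥ := by
      rw [q1, ← disjoint_iff, ← le_compl_iff_disjoint_left]
      exact hdS f hf
    have e2 : (eqnDiff f).eval c₁ q ⊓ dᶜ = ⊥ := by
      rw [q2, (eqnDiff_eval c₁ f a).2 (ha f hf), bot_inf_eq]
    rw [← inf_top_eq ((eqnDiff f).eval c₁ q), ← sup_compl_eq_top (x := d), inf_sup_left, e1, e2,
      sup_bot_eq]
  have h3 := (eqnDiff_eval c₁ e' q).2 (he hq e' rfl)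
  have h4 := q1 (eqnDiff e')
  rw [h3, bot_inf_eq, inf_eq_right.2 hdt] at h4
  exact hd0 h4.symm

theorem solSet_empty_of_radical {I B₁ B₂ : Type} [BooleanAlgebra B₁] [BooleanAlgebra B₂]
    (c₁ : I → B₁) (c₂ : I → B₂) (hC : SameConstAlg c₁ c₂) {n : ℕ} (S : Set (BEqn I n))
    (h : radical c₁ S ⊆ radical c₂ S) (h0 : solSet c₁ S = ∅) : solSet c₂ S = ∅ := by
  have hm : ((.bot, .top) : BEqn I n) ∈ radical c₁ S := by
    intro b hb
    rw [h0] at hb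
    exact hb.elim
  by_contra hne
  obtain ⟨b, hb⟩ := Set.nonempty_iff_ne_empty.2 hne
  have hbt : (⊥ : B₂) = ⊤ := h hm hb _ rfl
  have hbt1 : (⊥ : B₁) = ⊤ := (hC .bot .top).2 hbt
  have hs : Subsingleton B₁ := subsingleton_of_bot_eq_top hbt1
  have : (fun _ => ⊥ : Fin n → B₁) ∈ solSet c₁ S := fun _ _ => Subsingleton.elim _ _
  rw [h0] at this
  exact this

/-- View a closed term as a term in any number of variables. -/
def BTerm.lift0 {I : Type} {n : ℕ} : BTerm I 0 → BTerm I n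
  | .var i => i.elim0
  | .const j => .const j
  | .bot => .bot
  | .top => .top
  | .sup t s => .sup t.lift0 s.lift0
  | .inf t s => .inf t.lift0 s.lift0
  | .compl t => .compl t.lift0

theorem BTerm.eval_lift0 {I B : Type} [BooleanAlgebra B] (c : I → B) {n : ℕ}
    (z : Fin 0 → B) (b : Fin n → B) (r : BTerm I 0) :
    (r.lift0 : BTerm I n).eval c b = r.eval c z := by
  induction r with
  | var i => exact i.elim0
  | const j => rfl
  | bot => rfl
  | top => rfl
  | sup t s iht ihs => simp only [BTerm.lift0, BTerm.eval, iht, ihs]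
  | inf t s iht ihs => simp only [BTerm.lift0, BTerm.eval, iht, ihs]
  | compl t iht => simp only [BTerm.lift0, BTerm.eval, iht]

theorem isGLB_iff_radical {I B : Type} [BooleanAlgebra B] (c : I → B) (T : Set (BTerm I 0)) :
    IsGLB ((fun t : BTerm I 0 => t.eval c (fun i => i.elim0)) '' T) (⊥ : B) ↔
      ((.var 0, .bot) : BEqn I 1) ∈
        radical c ((fun t => ((.inf (.var 0) t.lift0, .var 0) : BEqn I 1)) '' T) := by
  rw [isGLB_bot_iff']
  constructor
  · intro h b hb e he
    obtain rfl : e = _ := he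
    refine h (b 0) ?_
    rintro _ ⟨t, ht, rfl⟩
    have := hb _ ⟨t, ht, rfl⟩
    simp only [BTerm.eval] at this
    rw [BTerm.eval_lift0 c (fun i => i.elim0)] at this
    exact inf_eq_left.1 this
  · intro h d hd
    refine h (a := fun _ => d) ?_ _ rfl
    rintro _ ⟨t, ht, rfl⟩
    simp only [BTerm.eval]
    rw [BTerm.eval_lift0 c (fun i => i.elim0)]
    exact inf_eq_left.2 (hd _ ⟨t, ht, rfl⟩)

/-- Theorem 8: two Boolean C-algebras `B₁, B₂` (with the same subalgebra of
constants) are geometrically equivalent iff (1) a system is inconsistent over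
`B₁` exactly when it is inconsistent over `B₂`, and (2) a set of constants has
an infimum equal to `0` in `B₁` exactly when it does in `B₂`. -/
theorem geomEquiv_iff {I B₁ B₂ : Type} [BooleanAlgebra B₁] [BooleanAlgebra B₂]
    (c₁ : I → B₁) (c₂ : I → B₂) (hC : SameConstAlg c₁ c₂) :
    GeomEquiv c₁ c₂ ↔
      ((∀ (n : ℕ) (S : Set (BEqn I n)), solSet c₁ S = ∅ ↔ solSet c₂ S = ∅) ∧
       (∀ T : Set (BTerm I 0),
          IsGLB ((fun t : BTerm I 0 => t.eval c₁ (fun i => i.elim0)) '' T)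
            (⊥ : B₁) ↔
          IsGLB ((fun t : BTerm I 0 => t.eval c₂ (fun i => i.elim0)) '' T)
            (⊥ : B₂))) := by
  constructor
  · intro h
    refine ⟨fun n S => ⟨solSet_empty_of_radical c₁ c₂ hC S (h n S).subset,
      solSet_empty_of_radical c₂ c₁ (fun t s => (hC t s).symm) S (h n S).symm.subset⟩, fun T => ?_⟩
    rw [isGLB_iff_radical, isGLB_iff_radical, h]
  · rintro ⟨h1, h2⟩ n S
    exact Set.Subset.antisymm
      (radical_sub c₁ c₂ S (h1 n S).1 fun T => (h2 T).1)
      (radical_sub c₂ c₁ S (h1 n S).2 fun T => (h2 T).2)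
end

section
/- Let B₁, B₂ be Boolean C-algebras whose constant symbols generate the same subalgebra C. Then B₁ and B₂ satisfy the same quasi-identities of the language L; equivalently, qvar(B₁) = qvar(B₂). -/
/-- Satisfaction of the quasi-identity
`∀X ((t₁=s₁) ∧ … ∧ (t_m=s_m) → (t=s))` in the algebra `B`. -/
def SatisfiesQI {I B : Type} [BooleanAlgebra B] (c : I → B) {n m : ℕ}
    (prem : Fin m → BEqn I n) (concl : BEqn I n) : Prop :=
  ∀ b : Fin n → B,
    (∀ i, (prem i).1.eval c b = (prem i).2.eval c b) →
    concl.1.eval c b = concl.2.eval c b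

/-- Closed substitution. -/
def BTerm.substC {I : Type} {n : ℕ} (τ : Fin n → BTerm I 0) : BTerm I n → BTerm I 0
  | .var i => τ i
  | .const j => .const j
  | .bot => .bot
  | .top => .top
  | .sup t s => .sup (t.substC τ) (s.substC τ)
  | .inf t s => .inf (t.substC τ) (s.substC τ)
  | .compl t => .compl (t.substC τ)

theorem BTerm.eval_substC {I B : Type} [BooleanAlgebra B] (c : I → B) {n : ℕ}
    (τ : Fin n → BTerm I 0) (t : BTerm I n) :
    (t.substC τ).eval c (fun i => i.elim0)
      = t.eval c (fun i => (τ i).eval c (fun i => i.elim0)) := by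
  induction t <;> simp_all [BTerm.substC, BTerm.eval]

/-- A function is local when it commutes with relativization. -/
def IsLoc {B : Type} [BooleanAlgebra B] {n : ℕ} (F : (Fin n → B) → B) : Prop :=
  ∀ b b' d, (∀ i, b i ⊓ d = b' i ⊓ d) → F b ⊓ d = F b' ⊓ d

section
variable {B : Type} [BooleanAlgebra B] {n : ℕ} {F G : (Fin n → B) → B}

theorem compl_loc {x y d : B} (h : x ⊓ d = y ⊓ d) : xᶜ ⊓ d = yᶜ ⊓ d := by
  have key : ∀ z : B, zᶜ ⊓ d = d \ (z ⊓ d) := by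
    intro z
    rw [sdiff_inf_self_right, sdiff_eq, inf_comm]
  rw [key, key, h]

theorem IsLoc.compl (hF : IsLoc F) : IsLoc (fun b => (F b)ᶜ) :=
  fun b b' d h => compl_loc (hF b b' d h)

theorem IsLoc.inf (hF : IsLoc F) (hG : IsLoc G) : IsLoc (fun b => F b ⊓ G b) := by
  intro b b' d h
  change F b ⊓ G b ⊓ d = F b' ⊓ G b' ⊓ d
  rw [inf_inf_distrib_right, hF b b' d h, hG b b' d h, ← inf_inf_distrib_right]

theorem IsLoc.sup (hF : IsLoc F) (hG : IsLoc G) : IsLoc (fun b => F b ⊔ G b) := by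
  intro b b' d h
  change (F b ⊔ G b) ⊓ d = (F b' ⊔ G b') ⊓ d
  rw [inf_sup_right, hF b b' d h, hG b b' d h, ← inf_sup_right]

theorem IsLoc.symmDiff (hF : IsLoc F) (hG : IsLoc G) : IsLoc (fun b => symmDiff (F b) (G b)) := by
  simp only [symmDiff_eq]
  exact (hF.inf hG.compl).sup (hG.inf hF.compl)

theorem IsLoc.cons {F : (Fin (n+1) → B) → B} (hF : IsLoc F) (a : B) :
    IsLoc (fun y : Fin n → B => F (Fin.cons a y)) := by
  intro b b' d h
  apply hF
  intro i
  refine Fin.cases ?_ (fun j => ?_) i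
  · simp
  · simpa using h j

theorem IsLoc.finsup {m : ℕ} {F : Fin m → (Fin n → B) → B} (hF : ∀ i, IsLoc (F i)) :
    IsLoc (fun b => Finset.univ.sup (fun i => F i b)) := by
  intro b b' d h
  change Finset.univ.sup (fun i => F i b) ⊓ d = Finset.univ.sup (fun i => F i b') ⊓ d
  rw [Finset.sup_inf_distrib_right, Finset.sup_inf_distrib_right]
  exact Finset.sup_congr rfl (fun i _ => hF i b b' d h)

theorem cons_bot {F : (Fin (n+1) → B) → B} (hF : IsLoc F) (x : B) (y : Fin n → B) :
    F (Fin.cons x y) ⊓ xᶜ = F (Fin.cons ⊥ y) ⊓ xᶜ := by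
  apply hF
  intro i
  refine Fin.cases ?_ (fun j => ?_) i <;> simp

theorem cons_top {F : (Fin (n+1) → B) → B} (hF : IsLoc F) (x : B) (y : Fin n → B) :
    F (Fin.cons x y) ⊓ x = F (Fin.cons ⊤ y) ⊓ x := by
  apply hF
  intro i
  refine Fin.cases ?_ (fun j => ?_) i <;> simp

theorem eq_bot_of_split {z x : B} (h1 : z ⊓ x = ⊥) (h2 : z ⊓ xᶜ = ⊥) : z = ⊥ := by
  rw [← inf_top_eq z, ← sup_compl_eq_top (x := x), inf_sup_left, h1, h2, sup_bot_eq]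

end

theorem exists_sol {B : Type} [BooleanAlgebra B] (C : Set B)
    (hinf : ∀ x ∈ C, ∀ y ∈ C, x ⊓ y ∈ C) (hbot : ⊥ ∈ C) (htop : ⊤ ∈ C) :
    ∀ (n : ℕ) (F : (Fin n → B) → B), IsLoc F → (∀ b, (∀ i, b i ∈ C) → F b ∈ C) →
      ∀ b, F b = ⊥ → ∃ y : Fin n → B, (∀ i, y i ∈ C) ∧ F y = ⊥ := by
  intro n
  induction n with
  | zero => exact fun F _ _ b hb => ⟨b, fun i => i.elim0, hb⟩
  | succ n ih =>
    intro F hF hFC b hb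
    have hc : ∀ a ∈ C, ∀ y : Fin n → B, (∀ i, y i ∈ C) →
        ∀ i, (Fin.cons a y : Fin (n+1) → B) i ∈ C := by
      intro a ha y hy i
      refine Fin.cases ?_ (fun j => ?_) i
      · simpa using ha
      · simpa using hy j
    obtain ⟨y, hy, hy0⟩ := ih (fun y => F (Fin.cons ⊥ y) ⊓ F (Fin.cons ⊤ y))
      ((hF.cons ⊥).inf (hF.cons ⊤))
      (fun y hy => hinf _ (hFC _ (hc _ hbot y hy)) _ (hFC _ (hc _ htop y hy)))
      (Fin.tail b) (by
        have h1 := cons_bot hF (b 0) (Fin.tail b)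
        have h2 := cons_top hF (b 0) (Fin.tail b)
        rw [Fin.cons_self_tail, hb, bot_inf_eq] at h1 h2
        apply eq_bot_of_split (x := b 0)
        · rw [inf_assoc, ← h2, inf_bot_eq]
        · rw [inf_right_comm, ← h1, bot_inf_eq])
    have hx := hFC _ (hc _ hbot y hy)
    refine ⟨Fin.cons (F (Fin.cons ⊥ y)) y, hc _ hx y hy, ?_⟩
    apply eq_bot_of_split (x := F (Fin.cons ⊥ y))
    · rw [cons_top hF, inf_comm]; exact hy0
    · rw [cons_bot hF, inf_compl_eq_bot]

theorem exists_vertex {B : Type} [BooleanAlgebra B] (C : Set B) (hbot : ⊥ ∈ C) (htop : ⊤ ∈ C) :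
    ∀ (n : ℕ) (G : (Fin n → B) → B), IsLoc G →
      ∀ b, G b ≠ ⊥ → ∃ e : Fin n → B, (∀ i, e i ∈ C) ∧ G e ≠ ⊥ := by
  intro n
  induction n with
  | zero => exact fun F _ b hb => ⟨b, fun i => i.elim0, hb⟩
  | succ n ih =>
    intro G hG b hb
    have : ∃ a ∈ C, G (Fin.cons a (Fin.tail b)) ≠ ⊥ := by
      by_contra! hcon
      apply hb
      have h1 := cons_bot hG (b 0) (Fin.tail b)
      have h2 := cons_top hG (b 0) (Fin.tail b)
      rw [Fin.cons_self_tail] at h1 h2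
      rw [hcon _ hbot, bot_inf_eq] at h1
      rw [hcon _ htop, bot_inf_eq] at h2
      exact eq_bot_of_split h2 h1
    obtain ⟨a, ha, hab⟩ := this
    obtain ⟨e, he, hGe⟩ := ih _ (hG.cons a) _ hab
    refine ⟨Fin.cons a e, fun i => ?_, hGe⟩
    refine Fin.cases ?_ (fun j => ?_) i
    · simpa using ha
    · simpa using he j

theorem eval_loc {I B : Type} [BooleanAlgebra B] (c : I → B) {n : ℕ} (t : BTerm I n) :
    IsLoc (t.eval c) := by
  induction t with
  | var i => exact fun b b' d h => h i
  | const j => exact fun b b' d h => rfl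
  | bot => exact fun b b' d h => rfl
  | top => exact fun b b' d h => rfl
  | sup t s ht hs => exact ht.sup hs
  | inf t s ht hs => exact ht.inf hs
  | compl t ht => exact ht.compl

theorem eval_mem {I B : Type} [BooleanAlgebra B] (c : I → B) {n : ℕ} (t : BTerm I n)
    (b : Fin n → B) (hb : ∀ i, b i ∈ constSubalg c) : t.eval c b ∈ constSubalg c := by
  choose τ hτ using hb
  refine ⟨t.substC τ, ?_⟩
  change (t.substC τ).eval c _ = _
  rw [BTerm.eval_substC]
  congr 1
  exact funext hτ

/-- A failing quasi-identity already fails on a tuple from `C`. -/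
theorem exists_const_failure {I B : Type} [BooleanAlgebra B] (c : I → B) {n m : ℕ}
    (prem : Fin m → BEqn I n) (concl : BEqn I n) (b : Fin n → B)
    (hp : ∀ i, (prem i).1.eval c b = (prem i).2.eval c b)
    (hq : concl.1.eval c b ≠ concl.2.eval c b) :
    ∃ x : Fin n → B, (∀ i, x i ∈ constSubalg c) ∧
      (∀ i, (prem i).1.eval c x = (prem i).2.eval c x) ∧
      concl.1.eval c x ≠ concl.2.eval c x := by
  have hbot : (⊥ : B) ∈ constSubalg c := ⟨.bot, rfl⟩
  have htop : (⊤ : B) ∈ constSubalg c := ⟨.top, rfl⟩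
  have hinf : ∀ x ∈ constSubalg c, ∀ y ∈ constSubalg c, x ⊓ y ∈ constSubalg c := by
    rintro _ ⟨t, rfl⟩ _ ⟨s, rfl⟩; exact ⟨.inf t s, rfl⟩
  have hsup : ∀ x ∈ constSubalg c, ∀ y ∈ constSubalg c, x ⊔ y ∈ constSubalg c := by
    rintro _ ⟨t, rfl⟩ _ ⟨s, rfl⟩; exact ⟨.sup t s, rfl⟩
  have hcompl : ∀ x ∈ constSubalg c, xᶜ ∈ constSubalg c := by
    rintro _ ⟨t, rfl⟩; exact ⟨.compl t, rfl⟩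
  have hsd : ∀ x ∈ constSubalg c, ∀ y ∈ constSubalg c, symmDiff x y ∈ constSubalg c := by
    intro x hx y hy
    rw [symmDiff_eq]
    exact hsup _ (hinf _ hx _ (hcompl _ hy)) _ (hinf _ hy _ (hcompl _ hx))
  let P : (Fin n → B) → B := fun b =>
    Finset.univ.sup (fun i => symmDiff ((prem i).1.eval c b) ((prem i).2.eval c b))
  let Q : (Fin n → B) → B := fun b => symmDiff (concl.1.eval c b) (concl.2.eval c b)
  have hP : IsLoc P := IsLoc.finsup (fun i => (eval_loc c _).symmDiff (eval_loc c _))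
  have hQ : IsLoc Q := (eval_loc c _).symmDiff (eval_loc c _)
  have hPiff : ∀ x, P x = ⊥ ↔ ∀ i, (prem i).1.eval c x = (prem i).2.eval c x := by
    intro x; simp [P, Finset.sup_eq_bot_iff]
  have hQiff : ∀ x, Q x = ⊥ ↔ concl.1.eval c x = concl.2.eval c x := by
    intro x; simp [Q]
  have hPC : ∀ x, (∀ i, x i ∈ constSubalg c) → P x ∈ constSubalg c := by
    intro x hx
    exact Finset.sup_mem _ hbot hsup _ _
      (fun i _ => hsd _ (eval_mem c _ x hx) _ (eval_mem c _ x hx))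
  have hQC : ∀ x, (∀ i, x i ∈ constSubalg c) → Q x ∈ constSubalg c := fun x hx =>
    hsd _ (eval_mem c _ x hx) _ (eval_mem c _ x hx)
  have hPb : P b = ⊥ := (hPiff b).2 hp
  obtain ⟨y, hy, hPy⟩ := exists_sol _ hinf hbot htop n P hP hPC b hPb
  obtain ⟨e, he, hGe⟩ := exists_vertex _ hbot htop n _ (hQ.inf hP.compl) b (by
    simp only [hPb, compl_bot, inf_top_eq]
    exact fun h => hq ((hQiff b).1 h))
  obtain ⟨d, hd⟩ : ∃ d, d = Q e ⊓ (P e)ᶜ := ⟨_, rfl⟩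
  have hdC : d ∈ constSubalg c := hd ▸ hinf _ (hQC e he) _ (hcompl _ (hPC e he))
  have hd0 : d ≠ ⊥ := hd ▸ hGe
  let x : Fin n → B := fun i => (e i ⊓ d) ⊔ (y i ⊓ dᶜ)
  have hx1 : ∀ i, x i ⊓ d = e i ⊓ d := by
    intro i; simp [x, inf_sup_right, inf_assoc]
  have hx2 : ∀ i, x i ⊓ dᶜ = y i ⊓ dᶜ := by
    intro i; simp [x, inf_sup_right, inf_assoc]
  refine ⟨x, fun i => hsup _ (hinf _ (he i) _ hdC) _ (hinf _ (hy i) _ (hcompl _ hdC)),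
    (hPiff x).1 ?_, fun h => hd0 ?_⟩
  · apply eq_bot_of_split (x := d)
    · rw [hP x e d hx1, hd, inf_left_comm, inf_compl_eq_bot, inf_bot_eq]
    · rw [hP x y _ hx2, hPy, bot_inf_eq]
  · have h1 := hQ x e d hx1
    rw [(hQiff x).2 h, bot_inf_eq] at h1
    rw [h1]
    exact (inf_eq_right.2 (hd ▸ inf_le_left)).symm

theorem satisfies_transfer {I B₁ B₂ : Type} [BooleanAlgebra B₁] [BooleanAlgebra B₂]
    (c₁ : I → B₁) (c₂ : I → B₂) (hC : SameConstAlg c₁ c₂) {n m : ℕ}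
    (prem : Fin m → BEqn I n) (concl : BEqn I n) (h : SatisfiesQI c₁ prem concl) :
    SatisfiesQI c₂ prem concl := by
  intro b hp
  by_contra hq
  obtain ⟨x, hx, hxp, hxq⟩ := exists_const_failure c₂ prem concl b hp hq
  choose τ hτ using hx
  have hτ' : (fun i => (τ i).eval c₂ (fun i => i.elim0)) = x := funext hτ
  have key : ∀ t s : BTerm I n,
      t.eval c₁ (fun i => (τ i).eval c₁ (fun i => i.elim0))
        = s.eval c₁ (fun i => (τ i).eval c₁ (fun i => i.elim0)) ↔
      t.eval c₂ x = s.eval c₂ x := by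
    intro t s
    have := hC (t.substC τ) (s.substC τ)
    simpa only [BTerm.eval_substC, hτ'] using this
  exact hxq ((key _ _).1 (h _ (fun i => (key _ _).2 (hxp i))))

/-- Theorem 9(2): two Boolean C-algebras with the same subalgebra of constants
satisfy the same quasi-identities of the language `L` (hence
`qvar(B₁) = qvar(B₂)`). -/
theorem same_quasiIdentities {I B₁ B₂ : Type} [BooleanAlgebra B₁] [BooleanAlgebra B₂]
    (c₁ : I → B₁) (c₂ : I → B₂) (hC : SameConstAlg c₁ c₂) :
    ∀ (n m : ℕ) (prem : Fin m → BEqn I n) (concl : BEqn I n),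
      SatisfiesQI c₁ prem concl ↔ SatisfiesQI c₂ prem concl := by
  intro n m prem concl
  exact ⟨satisfies_transfer c₁ c₂ hC prem concl,
    satisfies_transfer c₂ c₁ (fun t s => (hC t s).symm) prem concl⟩
end
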